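/- Finite policy set where all transition models are equivalent: let S = {s0, s1}, A = {a0, a1}, d0 uniform on S, R(s,a) = 1{s = s0, a = a0} + 1{s = s1, a = a1}, and γ ∈ (0,1). Let π_0 be the deterministic policy playing a0 at both states, π_1 play a0 at s0 and a1 at s1, and π_2 play a1 at s0 and a0 at s1. Then for EVERY transition model T : S × A → Δ(S), one has J_T(π_1) = 1/(1−γ) > J_T(π_0) > 0 = J_T(π_2). Consequently, every pair of transition models induces the same ordering on {π_0, π_1, π_2} (is equivalent there), even though γ > 0, R depends on both state and action, and the visit counts of these three policies are not collinear under any transition model. -/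

import Mathlib

open Matrix

/-- `p` is a probability distribution on the finite set `S`. -/
def IsDist {S : Type*} [Fintype S] (p : S → ℝ) : Prop :=
  (∀ s, 0 ≤ p s) ∧ ∑ s, p s = 1

/-- `π` is a stationary policy: each `π s` is a distribution over actions. -/
def IsPolicy {S A : Type*} [Fintype A] (π : S → A → ℝ) : Prop :=
  ∀ s, (∀ a, 0 ≤ π s a) ∧ ∑ a, π s a = 1

/-- `T` is a transition model: each `T s a` is a distribution over next states. -/
def IsTransModel {S A : Type*} [Fintype S] (T : S → A → S → ℝ) : Prop :=
  ∀ s a, (∀ s', 0 ≤ T s a s') ∧ ∑ s', T s a s' = 1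

/-- The policy-induced transition matrix `P^π(s,s') = Σ_a π(a|s) T(s'|s,a)`. -/
noncomputable def Pmat {S A : Type*} [Fintype A] (T : S → A → S → ℝ)
    (π : S → A → ℝ) : Matrix S S ℝ :=
  Matrix.of fun s s' => ∑ a, π s a * T s a s'

/-- The policy-induced expected reward vector `r^π(s) = Σ_a π(a|s) R(s,a)`. -/
noncomputable def rvec {S A : Type*} [Fintype A] (R : S → A → ℝ)
    (π : S → A → ℝ) : S → ℝ :=
  fun s => ∑ a, π s a * R s a

/-- The policy value `J(π) = Σ_s d0(s) V^π(s)` with `V^π = (I - γ P^π)⁻¹ r^π`. -/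
noncomputable def Jval {S A : Type*} [Fintype S] [Fintype A] [DecidableEq S]
    (T : S → A → S → ℝ) (R : S → A → ℝ) (d0 : S → ℝ) (γ : ℝ)
    (π : S → A → ℝ) : ℝ :=
  ∑ s, d0 s * (((1 : Matrix S S ℝ) - γ • Pmat T π)⁻¹ *ᵥ rvec R π) s

/-- Discounted visit counts `F^π(s,a) = μ^π(s) π(a|s)` with
`μ^π = (I - γ (P^π)ᵀ)⁻¹ d0`. -/
noncomputable def visitCount {S A : Type*} [Fintype S] [Fintype A] [DecidableEq S]
    (T : S → A → S → ℝ) (d0 : S → ℝ) (γ : ℝ) (π : S → A → ℝ) :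
    S → A → ℝ :=
  fun s a => ((((1 : Matrix S S ℝ) - γ • (Pmat T π)ᵀ)⁻¹) *ᵥ d0) s * π s a

/-- The policy value written as the inner product `J(π) = ⟨R, F^π⟩`. -/
noncomputable def JvisF {S A : Type*} [Fintype S] [Fintype A] [DecidableEq S]
    (T : S → A → S → ℝ) (R : S → A → ℝ) (d0 : S → ℝ) (γ : ℝ)
    (π : S → A → ℝ) : ℝ :=
  ∑ s, ∑ a, R s a * visitCount T d0 γ π s a

/-- The interior `Π⁺` of the policy space: policies with all entries positive. -/
def PiPlus {S A : Type*} [Fintype A] : Set (S → A → ℝ) :=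
  {π | IsPolicy π ∧ ∀ s a, 0 < π s a}

/-- Initial distribution: uniform on the two states. -/
noncomputable def d0₁₈ : Fin 2 → ℝ := fun _ => 1 / 2

/-- Reward `R(s,a) = 1{s = s₀, a = a₀} + 1{s = s₁, a = a₁}`. -/
noncomputable def R₁₈ : Fin 2 → Fin 2 → ℝ := fun s a => if s = a then 1 else 0

/-- `π₀` plays `a₀` at both states. -/
noncomputable def pol0 : Fin 2 → Fin 2 → ℝ := fun _ a => if a = 0 then 1 else 0

/-- `π₁` plays `a₀` at `s₀` and `a₁` at `s₁`. -/
noncomputable def pol1 : Fin 2 → Fin 2 → ℝ := fun s a => if a = s then 1 else 0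

/-- `π₂` plays `a₁` at `s₀` and `a₀` at `s₁`. -/
noncomputable def pol2 : Fin 2 → Fin 2 → ℝ := fun s a => if a = s then 0 else 1

theorem Pmat_nonneg {S A : Type*} [Fintype S] [Fintype A] {T : S → A → S → ℝ} {π : S → A → ℝ}
    (hT : IsTransModel T) (hπ : IsPolicy π) (s s' : S) : 0 ≤ Pmat T π s s' :=
  Finset.sum_nonneg fun a _ => mul_nonneg ((hπ s).1 a) ((hT s a).1 s')

theorem Pmat_row_sum {S A : Type*} [Fintype S] [Fintype A] {T : S → A → S → ℝ} {π : S → A → ℝ}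
    (hT : IsTransModel T) (hπ : IsPolicy π) (s : S) : ∑ s', Pmat T π s s' = 1 := by
  simp only [Pmat, of_apply]
  rw [Finset.sum_comm]
  simp_rw [← Finset.mul_sum, (hT s _).2, mul_one]
  exact (hπ s).2

theorem isPolicy_pol0 : IsPolicy pol0 := fun s =>
  ⟨fun a => by unfold pol0; positivity, by simp [pol0]⟩

theorem isPolicy_pol1 : IsPolicy pol1 := fun s =>
  ⟨fun a => by unfold pol1; positivity, by simp [pol1]⟩

theorem isPolicy_pol2 : IsPolicy pol2 := fun s =>
  ⟨fun a => by unfold pol2; positivity, by fin_cases s <;> simp [pol2]⟩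

theorem rvec_pol0 : rvec R₁₈ pol0 = ![1, 0] := by
  ext s; fin_cases s <;> simp [rvec, R₁₈, pol0]

theorem rvec_pol1 : rvec R₁₈ pol1 = ![1, 1] := by
  ext s; fin_cases s <;> simp [rvec, R₁₈, pol1]

theorem rvec_pol2 : rvec R₁₈ pol2 = 0 := by
  ext s; fin_cases s <;> simp [rvec, R₁₈, pol2]

/-- The determinant of `I - γP` for a row-stochastic `2 × 2` matrix `P`. -/
theorem det_one_sub_smul_of_row_sum {γ : ℝ} {P : Matrix (Fin 2) (Fin 2) ℝ}
    (hP : ∀ s, ∑ s', P s s' = 1) :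
    (1 - γ • P).det = (1 - γ) * (1 - γ + γ * (P 0 1 + P 1 0)) := by
  have h0 : P 0 0 = 1 - P 0 1 := by have := hP 0; rw [Fin.sum_univ_two] at this; linarith
  have h1 : P 1 1 = 1 - P 1 0 := by have := hP 1; rw [Fin.sum_univ_two] at this; linarith
  simp [det_fin_two, h0, h1]
  ring

/-- The uniformly weighted value of a reward vector in a two-state chain. -/
theorem sum_inv_one_sub_smul_mulVec {γ : ℝ} {P : Matrix (Fin 2) (Fin 2) ℝ}
    (hP : ∀ s, ∑ s', P s s' = 1) (r : Fin 2 → ℝ) :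
    ∑ s, d0₁₈ s * ((1 - γ • P)⁻¹ *ᵥ r) s =
      ((1 - γ + 2 * γ * P 1 0) * r 0 + (1 - γ + 2 * γ * P 0 1) * r 1) /
        (2 * ((1 - γ) * (1 - γ + γ * (P 0 1 + P 1 0)))) := by
  have h0 : P 0 0 = 1 - P 0 1 := by have := hP 0; rw [Fin.sum_univ_two] at this; linarith
  have h1 : P 1 1 = 1 - P 1 0 := by have := hP 1; rw [Fin.sum_univ_two] at this; linarith
  rw [inv_def, det_one_sub_smul_of_row_sum hP, Ring.inverse_eq_inv', adjugate_fin_two]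
  generalize (1 - γ) * (1 - γ + γ * (P 0 1 + P 1 0)) = D
  simp [d0₁₈, mulVec, dotProduct, Fin.sum_univ_two, h0, h1]
  ring

/-- In a two-state chain started uniformly, every state has positive discounted occupancy. -/
theorem occupancy_pos {γ : ℝ} (hγ0 : 0 < γ) (hγ1 : γ < 1) {P : Matrix (Fin 2) (Fin 2) ℝ}
    (hnn : ∀ s s', 0 ≤ P s s') (hP : ∀ s, ∑ s', P s s' = 1) (s : Fin 2) :
    0 < ((1 - γ • Pᵀ)⁻¹ *ᵥ d0₁₈) s := by
  have h0 : P 0 0 = 1 - P 0 1 := by have := hP 0; rw [Fin.sum_univ_two] at this; linarith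
  have h1 : P 1 1 = 1 - P 1 0 := by have := hP 1; rw [Fin.sum_univ_two] at this; linarith
  have ha := mul_nonneg hγ0.le (hnn 0 1)
  have hb := mul_nonneg hγ0.le (hnn 1 0)
  have hdet : (1 - γ • Pᵀ).det = (1 - γ) * (1 - γ + γ * (P 0 1 + P 1 0)) := by
    rw [← det_one_sub_smul_of_row_sum hP, ← det_transpose]
    simp
  have hpos : 0 < ((1 - γ) * (1 - γ + γ * (P 0 1 + P 1 0)))⁻¹ :=
    inv_pos.2 (mul_pos (by linarith) (by linarith))
  rw [inv_def, hdet, Ring.inverse_eq_inv', adjugate_fin_two, smul_mulVec]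
  refine mul_pos hpos ?_
  fin_cases s <;> simp [d0₁₈, mulVec, dotProduct, Fin.sum_univ_two, h0, h1] <;> linarith

theorem Jval_pol1 {γ : ℝ} (hγ0 : 0 < γ) (hγ1 : γ < 1) {T : Fin 2 → Fin 2 → Fin 2 → ℝ}
    (hT : IsTransModel T) : Jval T R₁₈ d0₁₈ γ pol1 = 1 / (1 - γ) := by
  have ha := mul_nonneg hγ0.le (Pmat_nonneg hT isPolicy_pol1 0 1)
  have hb := mul_nonneg hγ0.le (Pmat_nonneg hT isPolicy_pol1 1 0)
  have hd : 1 - γ + γ * (Pmat T pol1 0 1 + Pmat T pol1 1 0) ≠ 0 := by linarith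
  have hγ : 1 - γ ≠ 0 := by linarith
  rw [Jval, sum_inv_one_sub_smul_mulVec (Pmat_row_sum hT isPolicy_pol1), rvec_pol1,
    div_eq_div_iff (by positivity) hγ]
  simp
  ring

theorem Jval_pol2 (γ : ℝ) (T : Fin 2 → Fin 2 → Fin 2 → ℝ) :
    Jval T R₁₈ d0₁₈ γ pol2 = 0 := by
  simp [Jval, rvec_pol2]

theorem Jval_pol0_mem_Ioo {γ : ℝ} (hγ0 : 0 < γ) (hγ1 : γ < 1) {T : Fin 2 → Fin 2 → Fin 2 → ℝ}
    (hT : IsTransModel T) : Jval T R₁₈ d0₁₈ γ pol0 ∈ Set.Ioo 0 (1 / (1 - γ)) := by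
  have ha := mul_nonneg hγ0.le (Pmat_nonneg hT isPolicy_pol0 0 1)
  have hb := mul_nonneg hγ0.le (Pmat_nonneg hT isPolicy_pol0 1 0)
  have hγ : 0 < 1 - γ := by linarith
  have hd : 0 < 1 - γ + γ * (Pmat T pol0 0 1 + Pmat T pol0 1 0) := by linarith
  rw [Jval, sum_inv_one_sub_smul_mulVec (Pmat_row_sum hT isPolicy_pol0), rvec_pol0]
  simp only [cons_val_zero, cons_val_one, mul_one, mul_zero, add_zero]
  refine ⟨div_pos (by linarith) (by positivity), ?_⟩
  rw [div_lt_div_iff₀ (by positivity) hγ, one_mul, mul_left_comm, mul_comm _ (1 - γ)]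
  exact mul_lt_mul_of_pos_left (by linarith) hγ

theorem visitCount_pos {γ : ℝ} (hγ0 : 0 < γ) (hγ1 : γ < 1) {T : Fin 2 → Fin 2 → Fin 2 → ℝ}
    (hT : IsTransModel T) {π : Fin 2 → Fin 2 → ℝ} (hπ : IsPolicy π) {s a : Fin 2}
    (h : 0 < π s a) : 0 < visitCount T d0₁₈ γ π s a :=
  mul_pos (occupancy_pos hγ0 hγ1 (Pmat_nonneg hT hπ) (Pmat_row_sum hT hπ) s) h

/-- **A finite policy set on which all transition models are equivalent**: for
every transition model `T`, `J_T(π₁) = 1/(1-γ) > J_T(π₀) > 0 = J_T(π₂)`; hence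
every pair of transition models induces the same ordering on `{π₀, π₁, π₂}`,
even though `γ > 0`, `R` depends on state and action, and the visit counts of
the three policies are not collinear under any transition model. -/
theorem stmt18 (γ : ℝ) (hγ0 : 0 < γ) (hγ1 : γ < 1) :
    -- the value ordering is the same under every transition model
    (∀ T : Fin 2 → Fin 2 → Fin 2 → ℝ, IsTransModel T →
      Jval T R₁₈ d0₁₈ γ pol1 = 1 / (1 - γ) ∧
      Jval T R₁₈ d0₁₈ γ pol0 < Jval T R₁₈ d0₁₈ γ pol1 ∧
      0 < Jval T R₁₈ d0₁₈ γ pol0 ∧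
      Jval T R₁₈ d0₁₈ γ pol2 = 0) ∧
    -- consequently every pair of transition models is equivalent on `{π₀, π₁, π₂}`
    (∀ T T' : Fin 2 → Fin 2 → Fin 2 → ℝ, IsTransModel T → IsTransModel T' →
      ∀ π ∈ ({pol0, pol1, pol2} : Set (Fin 2 → Fin 2 → ℝ)),
      ∀ π' ∈ ({pol0, pol1, pol2} : Set (Fin 2 → Fin 2 → ℝ)),
        (Jval T R₁₈ d0₁₈ γ π' ≤ Jval T R₁₈ d0₁₈ γ π ↔
          Jval T' R₁₈ d0₁₈ γ π' ≤ Jval T' R₁₈ d0₁₈ γ π)) ∧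
    -- the visit counts of the three policies are not collinear under any model
    (∀ T : Fin 2 → Fin 2 → Fin 2 → ℝ, IsTransModel T →
      ¬ ∃ x u : Fin 2 → Fin 2 → ℝ,
        ∀ π ∈ ({pol0, pol1, pol2} : Set (Fin 2 → Fin 2 → ℝ)), ∃ c : ℝ,
          visitCount T d0₁₈ γ π = x + c • u) := by
  refine ⟨fun T hT => ?_, fun T T' hT hT' => ?_, fun T hT => ?_⟩
  · have h0 := Jval_pol0_mem_Ioo hγ0 hγ1 hT
    have h1 := Jval_pol1 hγ0 hγ1 hT
    exact ⟨h1, h1 ▸ h0.2, h0.1, Jval_pol2 γ T⟩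
  · obtain ⟨h0, h0'⟩ := Jval_pol0_mem_Ioo hγ0 hγ1 hT
    obtain ⟨k0, k0'⟩ := Jval_pol0_mem_Ioo hγ0 hγ1 hT'
    have hγ := h0.trans h0'
    rintro π (rfl | rfl | rfl) π' (rfl | rfl | rfl) <;>
      simp only [Jval_pol1 hγ0 hγ1 hT, Jval_pol1 hγ0 hγ1 hT', Jval_pol2, le_refl, h0.le, h0'.le,
        k0.le, k0'.le, h0.not_ge, h0'.not_ge, k0.not_ge, k0'.not_ge]
  · rintro ⟨x, u, h⟩
    obtain ⟨c₀, h₀⟩ := h pol0 (by simp)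
    obtain ⟨c₁, h₁⟩ := h pol1 (by simp)
    obtain ⟨c₂, h₂⟩ := h pol2 (by simp)
    have p₁ : 0 < visitCount T d0₁₈ γ pol1 1 1 :=
      visitCount_pos hγ0 hγ1 hT isPolicy_pol1 (by simp [pol1])
    have p₂ : 0 < visitCount T d0₁₈ γ pol2 0 1 :=
      visitCount_pos hγ0 hγ1 hT isPolicy_pol2 (by simp [pol2])
    have z₀ : visitCount T d0₁₈ γ pol0 0 1 = 0 := by simp [visitCount, pol0]
    have w₀ : visitCount T d0₁₈ γ pol0 1 1 = 0 := by simp [visitCount, pol0]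
    have z₂ : visitCount T d0₁₈ γ pol2 1 1 = 0 := by simp [visitCount, pol2]
    rw [h₀] at z₀ w₀
    rw [h₁] at p₁
    rw [h₂] at z₂ p₂
    simp only [Pi.add_apply, Pi.smul_apply, smul_eq_mul] at z₀ w₀ z₂ p₁ p₂
    -- only `pol1` visits `(1, 1)`, which forces the parameters of `pol0` and `pol2` to agree
    have hc : (c₀ - c₂) * u 1 1 = 0 := by linarith
    rcases mul_eq_zero.1 hc with hc | hu
    · rw [sub_eq_zero.1 hc] at z₀
      exact p₂.ne' z₀
    · rw [hu, mul_zero] at p₁ z₂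
      exact p₁.ne' z₂
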